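/- For α < 1 < β, the function P̂_{α,β}(z) = ∫₀^z (P_{α,β}(t) - 1)/t dt = Σ_{n≥1} ((β-α)/(πn²)) i (1 - e^{2πni(1-α)/(β-α)}) zⁿ is convex univalent on the unit disc. -/

import Mathlib

open Complex Metric

/-- The vertical strip mapping `P_{α,β}`. -/
noncomputable def P (α β : ℝ) (z : ℂ) : ℂ :=
  1 + (((β : ℂ) - α) / Real.pi) * Complex.I *
    Complex.log ((1 - Complex.exp (2 * Real.pi * Complex.I *
      (1 - (α : ℂ)) / ((β : ℂ) - α)) * z) / (1 - z))

/-- `P̂_{α,β}(z) = ∫₀^z (P_{α,β}(t) - 1)/t dt`, parametrized along the segment. -/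
noncomputable def Phat (α β : ℝ) (z : ℂ) : ℂ :=
  ∫ t in (0 : ℝ)..1, (P α β ((t : ℂ) * z) - 1) / ((t : ℂ) * z) * z

theorem Real.sinh_le_mul_cosh {h : ℝ} (hh : 0 ≤ h) : Real.sinh h ≤ h * Real.cosh h := by
  have hd : ∀ t : ℝ, HasDerivAt (fun t => t * Real.cosh t - Real.sinh t) (t * Real.sinh t) t := by
    intro t
    refine (((hasDerivAt_id t).mul (Real.hasDerivAt_cosh t)).sub
      (Real.hasDerivAt_sinh t)).congr_deriv ?_
    simp
  have hm : MonotoneOn (fun t => t * Real.cosh t - Real.sinh t) (Set.Ici 0) := by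
    refine monotoneOn_of_deriv_nonneg (convex_Ici 0)
      (fun t _ => (hd t).continuousAt.continuousWithinAt)
      (fun t _ => (hd t).differentiableAt.differentiableWithinAt) fun t ht => ?_
    rw [interior_Ici, Set.mem_Ioi] at ht
    rw [(hd t).deriv]
    exact mul_nonneg ht.le (Real.sinh_nonneg_iff.2 ht.le)
  have := hm (Set.mem_Ici.2 le_rfl) (Set.mem_Ici.2 hh) hh
  simpa using this

theorem Real.two_mul_cosh_sub_one_le (x : ℝ) : 2 * (Real.cosh x - 1) ≤ x * Real.sinh x := by
  wlog hx : 0 ≤ x generalizing x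
  · simpa using this (-x) (by linarith)
  have h1 := Real.sinh_le_mul_cosh (h := x / 2) (by linarith)
  have h2 : 0 ≤ Real.sinh (x / 2) := Real.sinh_nonneg_iff.2 (by linarith)
  have h3 : Real.cosh x = Real.cosh (x / 2) ^ 2 + Real.sinh (x / 2) ^ 2 := by
    rw [← Real.cosh_two_mul]; ring_nf
  have h4 : Real.sinh x = 2 * Real.sinh (x / 2) * Real.cosh (x / 2) := by
    rw [← Real.sinh_two_mul]; ring_nf
  have h5 := Real.cosh_sq (x / 2)
  rw [h3, h4]
  nlinarith [mul_le_mul_of_nonneg_left h1 h2]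

theorem Real.mul_cos_le_sin {y : ℝ} (hy : 0 ≤ y) (hy' : y ≤ Real.pi) :
    y * Real.cos y ≤ Real.sin y := by
  rcases lt_or_ge y (Real.pi / 2) with h | h
  · have h1 := Real.le_tan hy h
    have h2 : 0 < Real.cos y := Real.cos_pos_of_mem_Ioo ⟨by linarith, h⟩
    rw [Real.tan_eq_sin_div_cos, le_div_iff₀ h2] at h1
    exact h1
  · exact (mul_nonpos_of_nonneg_of_nonpos hy
      (Real.cos_nonpos_of_pi_div_two_le_of_le h (by linarith))).trans
      (Real.sin_nonneg_of_nonneg_of_le_pi hy hy')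

theorem mul_sinh_mul_sin_add_pos {x y a : ℝ} (hy : 0 < y) (hy' : y < Real.pi) (ha : 0 < a)
    (ha' : a < Real.pi) (h : x ≠ 0 ∨ y ≠ a) :
    0 < x * Real.sinh x * Real.sin y + (a - y) * (Real.cosh x * Real.cos y - Real.cos a) := by
  have hs : 0 < Real.sin y := Real.sin_pos_of_pos_of_lt_pi hy hy'
  have h1 := Real.two_mul_cosh_sub_one_le x
  have h2 : 0 ≤ Real.cosh x - 1 := by linarith [Real.one_le_cosh x]
  have h3 := Real.mul_cos_le_sin hy.le hy'.le
  have h4 := Real.mul_cos_le_sin (y := Real.pi - y) (by linarith) (by linarith)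
  rw [Real.cos_pi_sub, Real.sin_pi_sub] at h4
  have h5 : 0 ≤ 2 * Real.sin y + (a - y) * Real.cos y := by
    rcases le_total 0 (Real.cos y) with hc | hc <;> nlinarith
  rcases eq_or_ne y a with rfl | hne
  · have hx : x ≠ 0 := by simpa using h
    have : 0 < Real.cosh x - 1 := by linarith [Real.one_lt_cosh.2 hx]
    have : 0 < x * Real.sinh x := by linarith
    simpa using mul_pos this hs
  · have h6 : 0 < (a - y) * (Real.cos y - Real.cos a) := by
      rcases lt_or_gt_of_ne hne with hl | hl
      · exact mul_pos (by linarith)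
          (by linarith [Real.cos_lt_cos_of_nonneg_of_le_pi hy.le ha'.le hl])
      · exact mul_pos_of_neg_of_neg (by linarith)
          (by linarith [Real.cos_lt_cos_of_nonneg_of_le_pi ha.le hy'.le hl])
    nlinarith [mul_nonneg h2 h5, mul_le_mul_of_nonneg_right h1 hs.le]

section ConvexImage

variable {f g g' : ℂ → ℂ}

theorem injOn_of_re_deriv_pos {s : Set ℂ} (hs : Convex ℝ s)
    (hf : ∀ z ∈ s, HasDerivAt f (g z) z) (hre : ∀ z ∈ s, 0 < (g z).re) : Set.InjOn f s := by
  intro z hz w hw hzw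
  by_contra hne
  have hwz : w - z ≠ 0 := sub_ne_zero.2 (Ne.symm hne)
  have hmem : ∀ t ∈ Set.Icc (0 : ℝ) 1, z + t * (w - z) ∈ s := fun t ht => by
    have := hs.add_smul_sub_mem hz hw ht
    simpa using this
  have hline : ∀ t : ℝ, HasDerivAt (fun t : ℝ => z + t * (w - z)) (w - z) t := fun t => by
    simpa using ((Complex.ofRealCLM.hasDerivAt (x := t)).mul_const (w - z)).const_add z
  have hd : ∀ t ∈ Set.Icc (0 : ℝ) 1,
      HasDerivAt (fun t : ℝ => (f (z + t * (w - z)) / (w - z)).re) (g (z + t * (w - z))).re t := by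
    intro t ht
    have h1 := ((hf _ (hmem t ht)).comp_of_eq t (hline t) rfl).div_const (w - z)
    have h2 := Complex.reCLM.hasFDerivAt.comp_hasDerivAt t h1
    refine h2.congr_deriv ?_
    simp [mul_div_cancel_right₀ _ hwz]
  have hmono : StrictMonoOn (fun t : ℝ => (f (z + t * (w - z)) / (w - z)).re) (Set.Icc 0 1) := by
    refine strictMonoOn_of_deriv_pos (convex_Icc 0 1)
      (fun t ht => (hd t ht).continuousAt.continuousWithinAt) fun t ht => ?_
    rw [(hd t (interior_subset ht)).deriv]
    exact hre _ (hmem t (interior_subset ht))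
  have := hmono (Set.left_mem_Icc.2 zero_le_one) (Set.right_mem_Icc.2 zero_le_one) one_pos
  simp [hzw] at this

/-- On the circle `|z| = r` the argument of the normal `z * g z` to the image curve increases
by `2 * π`, which makes the tangent line at each point of that curve a supporting line. -/
theorem re_conj_mul_sub_nonpos_of_circleMap
    (hf : ∀ z ∈ ball (0 : ℂ) 1, HasDerivAt f (g z) z)
    (hg : ∀ z ∈ ball (0 : ℂ) 1, HasDerivAt g (g' z) z)
    (hre : ∀ z ∈ ball (0 : ℂ) 1, 0 < (g z).re)
    (hst : ∀ z ∈ ball (0 : ℂ) 1, 0 ≤ (1 + z * g' z / g z).re)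
    {r : ℝ} (hr : 0 < r) (hr1 : r < 1) {s t : ℝ} (hst₁ : s ≤ t) (hst₂ : t ≤ s + 2 * Real.pi) :
    ((starRingEnd ℂ) (circleMap 0 r s * g (circleMap 0 r s)) *
      (f (circleMap 0 r t) - f (circleMap 0 r s))).re ≤ 0 := by
  have hc : ∀ t, circleMap 0 r t ∈ ball (0 : ℂ) 1 := fun t => by
    simpa [abs_of_pos hr] using hr1
  set A : ℝ → ℝ := fun t => t + (Complex.log (g (circleMap 0 r t))).im with hA
  have hdA : ∀ t, HasDerivAt A
      (1 + circleMap 0 r t * g' (circleMap 0 r t) / g (circleMap 0 r t)).re t := by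
    intro t
    have h1 := ((hg _ (hc t)).comp t (hasDerivAt_circleMap 0 r t)).clog_real
      (Or.inl (hre _ (hc t)))
    have h2 := (hasDerivAt_id t).add (Complex.imCLM.hasFDerivAt.comp_hasDerivAt t h1)
    refine h2.congr_deriv ?_
    have : g' (circleMap 0 r t) * (circleMap 0 r t * I) / g (circleMap 0 r t) =
      circleMap 0 r t * g' (circleMap 0 r t) / g (circleMap 0 r t) * I := by ring
    simp [this]
  have hmono : Monotone A := monotone_of_deriv_nonneg (fun t => (hdA t).differentiableAt)
    fun t => by rw [(hdA t).deriv]; exact hst _ (hc t)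
  have hAs : A (s + 2 * Real.pi) = A s + 2 * Real.pi := by
    simp only [hA, periodic_circleMap 0 r s]; ring
  have hpolar : ∀ t, circleMap 0 r t * g (circleMap 0 r t) =
      (r * ‖g (circleMap 0 r t)‖ : ℝ) * Complex.exp (A t * I) := by
    intro t
    conv_lhs => rw [← Complex.norm_mul_exp_arg_mul_I (g (circleMap 0 r t))]
    simp only [hA, Complex.log_im, circleMap_zero]
    push_cast
    rw [add_mul, Complex.exp_add]
    ring
  set N := (starRingEnd ℂ) (circleMap 0 r s * g (circleMap 0 r s)) with hN
  have hdF : ∀ t, HasDerivAt (fun t => (N * f (circleMap 0 r t)).re)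
      (-(r * ‖g (circleMap 0 r s)‖ * (r * ‖g (circleMap 0 r t)‖) * Real.sin (A t - A s))) t := by
    intro t
    have h1 := (((hf _ (hc t)).comp t (hasDerivAt_circleMap 0 r t)).const_mul N)
    have h2 := Complex.reCLM.hasFDerivAt.comp_hasDerivAt t h1
    refine h2.congr_deriv ?_
    have h3 : N * (g (circleMap 0 r t) * (circleMap 0 r t * I)) =
        (r * ‖g (circleMap 0 r s)‖ * (r * ‖g (circleMap 0 r t)‖) : ℝ) *
          (Complex.exp ((A t - A s : ℝ) * I) * I) := by
      rw [show g (circleMap 0 r t) * (circleMap 0 r t * I) =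
        circleMap 0 r t * g (circleMap 0 r t) * I by ring, hpolar t, hN, hpolar s, map_mul,
        ← Complex.exp_conj, map_mul, Complex.conj_I, Complex.conj_ofReal, Complex.conj_ofReal]
      have : Complex.exp ((A t - A s : ℝ) * I) =
          Complex.exp (A s * -I) * Complex.exp (A t * I) := by
        rw [← Complex.exp_add]; push_cast; ring_nf
      rw [this]
      push_cast
      ring
    simp only [Complex.reCLM_apply]
    rw [h3, Complex.re_ofReal_mul, Complex.mul_I_re, Complex.exp_ofReal_mul_I_im, mul_neg]
  have hpi := Real.pi_pos
  obtain ⟨m, hm, hAm⟩ : A s + Real.pi ∈ A '' Set.Icc s (s + 2 * Real.pi) :=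
    intermediate_value_Icc (by linarith) (fun t _ => (hdA t).continuousAt.continuousWithinAt)
      ⟨by linarith, by linarith⟩
  have hnn : ∀ t, 0 ≤ r * ‖g (circleMap 0 r s)‖ * (r * ‖g (circleMap 0 r t)‖) := fun t => by
    positivity
  have hle : (N * f (circleMap 0 r t)).re ≤ (N * f (circleMap 0 r s)).re := by
    rcases le_total t m with htm | htm
    · have hanti : AntitoneOn (fun t => (N * f (circleMap 0 r t)).re) (Set.Icc s m) := by
        refine antitoneOn_of_deriv_nonpos (convex_Icc s m)
          (fun t _ => (hdF t).continuousAt.continuousWithinAt)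
          (fun t _ => (hdF t).differentiableAt.differentiableWithinAt) fun t ht => ?_
        have ht := interior_subset ht
        rw [(hdF t).deriv]
        have := Real.sin_nonneg_of_nonneg_of_le_pi (x := A t - A s)
          (by linarith [hmono ht.1]) (by linarith [hmono ht.2])
        linarith [mul_nonneg (hnn t) this]
      exact hanti ⟨le_rfl, hm.1⟩ ⟨hst₁, htm⟩ hst₁
    · have hmon : MonotoneOn (fun t => (N * f (circleMap 0 r t)).re)
          (Set.Icc m (s + 2 * Real.pi)) := by
        refine monotoneOn_of_deriv_nonneg (convex_Icc m _)
          (fun t _ => (hdF t).continuousAt.continuousWithinAt)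
          (fun t _ => (hdF t).differentiableAt.differentiableWithinAt) fun t ht => ?_
        have ht := interior_subset ht
        rw [(hdF t).deriv]
        have := Real.sin_nonneg_of_nonneg_of_le_pi (x := A t - A s - Real.pi)
          (by linarith [hmono ht.1]) (by linarith [hmono ht.2])
        rw [Real.sin_sub_pi] at this
        linarith [mul_nonneg (hnn t) this]
      have := hmon ⟨htm, hst₂⟩ ⟨hm.2, le_rfl⟩ hst₂
      simpa only [periodic_circleMap 0 r s] using this
  rw [mul_sub, Complex.sub_re]
  linarith

theorem re_conj_mul_sub_nonpos
    (hf : ∀ z ∈ ball (0 : ℂ) 1, HasDerivAt f (g z) z)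
    (hg : ∀ z ∈ ball (0 : ℂ) 1, HasDerivAt g (g' z) z)
    (hre : ∀ z ∈ ball (0 : ℂ) 1, 0 < (g z).re)
    (hst : ∀ z ∈ ball (0 : ℂ) 1, 0 ≤ (1 + z * g' z / g z).re)
    {r : ℝ} (hr : 0 < r) (hr1 : r < 1) {w z : ℂ} (hw : w ∈ sphere (0 : ℂ) r)
    (hz : z ∈ closedBall (0 : ℂ) r) :
    ((starRingEnd ℂ) (w * g w) * (f z - f w)).re ≤ 0 := by
  have hsub : closedBall (0 : ℂ) r ⊆ ball 0 1 := closedBall_subset_ball hr1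
  set h : ℂ → ℂ := fun z => Complex.exp ((starRingEnd ℂ) (w * g w) * (f z - f w)) with hh
  have hd : DiffContOnCl ℂ h (ball 0 r) := by
    refine DifferentiableOn.diffContOnCl fun z hz => ?_
    rw [closure_ball _ hr.ne'] at hz
    exact (((((hf z (hsub hz)).sub_const _).const_mul _).cexp).differentiableAt).differentiableWithinAt
  have hbd : ∀ z ∈ frontier (ball (0 : ℂ) r), ‖h z‖ ≤ 1 := by
    intro z hz
    rw [frontier_ball _ hr.ne', ← abs_of_pos hr, ← range_circleMap] at hz
    obtain ⟨t, rfl⟩ := hz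
    have hw' := hw
    rw [← abs_of_pos hr, ← range_circleMap] at hw'
    obtain ⟨s, hs⟩ := hw'
    obtain ⟨t', ht', htt⟩ := (periodic_circleMap 0 r).exists_mem_Ico Real.two_pi_pos t s
    rw [hh, Complex.norm_exp, Real.exp_le_one_iff, htt, ← hs]
    exact re_conj_mul_sub_nonpos_of_circleMap hf hg hre hst hr hr1 ht'.1 ht'.2.le
  have := Complex.norm_le_of_forall_mem_frontier_norm_le isBounded_ball hd hbd
    (z := z) (by rwa [closure_ball _ hr.ne'])
  rwa [hh, Complex.norm_exp, Real.exp_le_one_iff] at this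

theorem convex_image_ball_of_lt_one
    (hf : ∀ z ∈ ball (0 : ℂ) 1, HasDerivAt f (g z) z)
    (hg : ∀ z ∈ ball (0 : ℂ) 1, HasDerivAt g (g' z) z)
    (hre : ∀ z ∈ ball (0 : ℂ) 1, 0 < (g z).re)
    (hst : ∀ z ∈ ball (0 : ℂ) 1, 0 ≤ (1 + z * g' z / g z).re)
    {r : ℝ} (hr : 0 < r) (hr1 : r < 1) : Convex ℝ (f '' ball 0 r) := by
  have hsub : closedBall (0 : ℂ) r ⊆ ball 0 1 := closedBall_subset_ball hr1
  have hne : ∀ z ∈ ball (0 : ℂ) 1, g z ≠ 0 := fun z hz h => by simpa [h] using hre z hz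
  set K : Set ℂ := ⋂ w ∈ sphere (0 : ℂ) r,
    {ζ | ((starRingEnd ℂ) (w * g w) * (ζ - f w)).re ≤ 0} with hK
  have hKc : Convex ℝ K := by
    refine convex_iInter₂ fun w _ => ?_
    intro x hx y hy a b ha hb hab
    simp only [Set.mem_ofPred_eq] at hx hy ⊢
    have : (starRingEnd ℂ) (w * g w) * (a • x + b • y - f w) =
        (a : ℂ) * ((starRingEnd ℂ) (w * g w) * (x - f w)) +
        (b : ℂ) * ((starRingEnd ℂ) (w * g w) * (y - f w)) := by
      have hab' : (a : ℂ) + b = 1 := by exact_mod_cast hab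
      simp only [Complex.real_smul]
      linear_combination ((starRingEnd ℂ) (w * g w) * f w) * hab'
    rw [this, Complex.add_re, Complex.re_ofReal_mul, Complex.re_ofReal_mul]
    nlinarith
  have hcont : ContinuousOn f (closedBall 0 r) := fun z hz =>
    (hf z (hsub hz)).continuousAt.continuousWithinAt
  have hopen : IsOpen (f '' ball 0 r) := by
    rw [isOpen_iff_mem_nhds]
    rintro _ ⟨z, hz, rfl⟩
    have hz1 := hsub (ball_subset_closedBall hz)
    have hstrict : HasStrictDerivAt f (g z) z := by
      have hd : DifferentiableOn ℂ f (ball 0 1) := fun z hz =>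
        (hf z hz).differentiableAt.differentiableWithinAt
      have := ((hd.analyticAt (isOpen_ball.mem_nhds hz1))).hasStrictDerivAt
      rwa [(hf z hz1).deriv] at this
    rw [← hstrict.map_nhds_eq (hne z hz1)]
    exact Filter.image_mem_map (isOpen_ball.mem_nhds hz)
  have hsubK : f '' ball 0 r ⊆ interior K := by
    refine interior_maximal ?_ hopen
    rintro _ ⟨z, hz, rfl⟩
    refine Set.mem_iInter₂.2 fun w hw => ?_
    exact re_conj_mul_sub_nonpos hf hg hre hst hr hr1 hw (ball_subset_closedBall hz)
  have hsphere : ∀ w ∈ sphere (0 : ℂ) r, f w ∉ interior K := by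
    intro w hw hwK
    have hN : w * g w ≠ 0 := mul_ne_zero (ne_zero_of_mem_sphere hr.ne' ⟨w, hw⟩)
      (hne w (hsub (sphere_subset_closedBall hw)))
    have htend : Filter.Tendsto (fun t : ℝ => f w + t * (w * g w)) (nhdsWithin 0 (Set.Ioi 0))
        (nhds (f w)) := by
      have : Continuous (fun t : ℝ => f w + t * (w * g w)) := by fun_prop
      simpa using (this.tendsto 0).mono_left nhdsWithin_le_nhds
    obtain ⟨t, htK, ht⟩ := ((htend.eventually (mem_interior_iff_mem_nhds.1 hwK)).and
      self_mem_nhdsWithin).exists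
    have h1 : ((starRingEnd ℂ) (w * g w) * (f w + t * (w * g w) - f w)).re ≤ 0 :=
      Set.mem_iInter₂.1 htK w hw
    have h2 : (starRingEnd ℂ) (w * g w) * (f w + t * (w * g w) - f w) =
        ((t * Complex.normSq (w * g w) : ℝ) : ℂ) := by
      rw [Complex.ofReal_mul, Complex.normSq_eq_conj_mul_self]
      ring
    rw [h2, Complex.ofReal_re] at h1
    exact absurd h1 (not_le.2 (mul_pos ht (Complex.normSq_pos.2 hN)))
  have hKsub : interior K ⊆ f '' ball 0 r := by
    refine hKc.interior.isPreconnected.subset_left_of_subset_union hopen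
      ((isCompact_closedBall (0 : ℂ) r).image_of_continuousOn hcont).isClosed.isOpen_compl
      (disjoint_compl_right.mono_left (Set.image_mono ball_subset_closedBall)) ?_
      ⟨f 0, hsubK ⟨0, mem_ball_self hr, rfl⟩, 0, mem_ball_self hr, rfl⟩
    intro ζ hζ
    by_contra hcon
    rw [Set.mem_union, not_or, Set.notMem_compl_iff] at hcon
    obtain ⟨h1, z, hz, rfl⟩ := hcon
    rw [← ball_union_sphere] at hz
    rcases hz with hz | hz
    · exact h1 ⟨z, hz, rfl⟩
    · exact hsphere z hz hζ
  rw [hsubK.antisymm hKsub]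
  exact hKc.interior

/-- A holomorphic function on the unit disc with `0 < re f'` and `0 ≤ re (1 + z f'' / f')`
has convex image. -/
theorem convex_image_unit_ball
    (hf : ∀ z ∈ ball (0 : ℂ) 1, HasDerivAt f (g z) z)
    (hg : ∀ z ∈ ball (0 : ℂ) 1, HasDerivAt g (g' z) z)
    (hre : ∀ z ∈ ball (0 : ℂ) 1, 0 < (g z).re)
    (hst : ∀ z ∈ ball (0 : ℂ) 1, 0 ≤ (1 + z * g' z / g z).re) :
    Convex ℝ (f '' ball 0 1) := by
  rw [convex_iff_segment_subset]
  rintro _ ⟨z, hz, rfl⟩ _ ⟨w, hw, rfl⟩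
  rw [mem_ball_zero_iff] at hz hw
  obtain ⟨r, hr, hr1⟩ := exists_between (max_lt hz hw)
  have hr0 : 0 < r := (norm_nonneg z).trans_lt ((le_max_left _ _).trans_lt hr)
  have h := (convex_image_ball_of_lt_one hf hg hre hst hr0 hr1).segment_subset
    (Set.mem_image_of_mem f (mem_ball_zero_iff.2 ((le_max_left _ _).trans_lt hr)))
    (Set.mem_image_of_mem f (mem_ball_zero_iff.2 ((le_max_right _ _).trans_lt hr)))
  exact h.trans (Set.image_mono (ball_subset_ball hr1.le))

end ConvexImage

/-- The principal logarithm of the Möbius map `(1 - e^{2ai} z) / (1 - z)`; for `0 < a < π` it maps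
the unit disc onto a strip of height `π`. -/
noncomputable def stripLog (a : ℝ) (z : ℂ) : ℂ :=
  Complex.log ((1 - Complex.exp (2 * a * Complex.I) * z) / (1 - z))

section StripLog

variable {a : ℝ} {z : ℂ}

theorem one_sub_re_pos (hz : ‖z‖ < 1) : 0 < (1 - z).re := by
  have := (Complex.re_le_norm z).trans_lt hz
  simpa using this

theorem norm_exp_two_mul_I_mul (a : ℝ) (z : ℂ) : ‖Complex.exp (2 * a * Complex.I) * z‖ = ‖z‖ := by
  have := Complex.norm_exp_ofReal_mul_I (2 * a)
  push_cast at this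
  rw [norm_mul, this, one_mul]

theorem one_sub_exp_mul_re_pos (a : ℝ) (hz : ‖z‖ < 1) :
    0 < (1 - Complex.exp (2 * a * Complex.I) * z).re :=
  one_sub_re_pos (by rwa [norm_exp_two_mul_I_mul])

theorem one_sub_exp_two_mul_I_ne_zero (ha : 0 < a) (ha' : a < Real.pi) :
    1 - Complex.exp (2 * a * Complex.I) ≠ 0 := by
  intro h
  have h1 : Complex.exp (a * Complex.I) * Complex.exp (a * Complex.I) = 1 := by
    rw [← Complex.exp_add, ← add_mul, ← two_mul, eq_comm, ← sub_eq_zero, h]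
  have hs := Real.sin_pos_of_pos_of_lt_pi ha ha'
  rcases mul_self_eq_one_iff.1 h1 with h2 | h2 <;>
  · have := Complex.exp_ofReal_mul_I_im a
    rw [h2] at this
    simp at this
    linarith

theorem stripLog_eq_sub (hz : ‖z‖ < 1) : stripLog a z =
    Complex.log (1 - Complex.exp (2 * a * Complex.I) * z) - Complex.log (1 - z) := by
  have h1 := one_sub_re_pos hz
  have h2 := one_sub_exp_mul_re_pos a hz
  have h3 := abs_lt.1 (Complex.abs_arg_lt_pi_div_two_iff.2 (Or.inl h1))
  have h4 := abs_lt.1 (Complex.abs_arg_lt_pi_div_two_iff.2 (Or.inl h2))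
  rw [← Complex.log_im] at h3 h4
  rw [stripLog, ← Complex.log_exp (x := Complex.log (1 - Complex.exp (2 * a * Complex.I) * z) -
      Complex.log (1 - z)), Complex.exp_sub,
    Complex.exp_log (ne_zero_of_re_pos h2), Complex.exp_log (ne_zero_of_re_pos h1)]
  · rw [Complex.sub_im]; linarith
  · rw [Complex.sub_im]; linarith

theorem exp_stripLog (hz : ‖z‖ < 1) : Complex.exp (stripLog a z) =
    (1 - Complex.exp (2 * a * Complex.I) * z) / (1 - z) :=
  Complex.exp_log (div_ne_zero (ne_zero_of_re_pos (one_sub_exp_mul_re_pos a hz))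
    (ne_zero_of_re_pos (one_sub_re_pos hz)))

theorem hasDerivAt_stripLog (hz : ‖z‖ < 1) : HasDerivAt (stripLog a)
    ((1 - Complex.exp (2 * a * Complex.I)) /
      ((1 - z) * (1 - Complex.exp (2 * a * Complex.I) * z))) z := by
  have h1 := one_sub_re_pos hz
  have h2 := one_sub_exp_mul_re_pos a hz
  have h1' := ne_zero_of_re_pos h1
  have h2' := ne_zero_of_re_pos h2
  set e := Complex.exp (2 * a * Complex.I) with he
  have hd : HasDerivAt (fun z => Complex.log (1 - e * z) - Complex.log (1 - z))
      (-(e * 1) / (1 - e * z) - -1 / (1 - z)) z :=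
    ((((hasDerivAt_id z).const_mul e).const_sub 1).clog (Or.inl h2)).sub
      (((hasDerivAt_id z).const_sub 1).clog (Or.inl h1))
  refine (hd.congr_of_eventuallyEq ?_).congr_deriv ?_
  · filter_upwards [isOpen_ball.mem_nhds (mem_ball_zero_iff.2 hz)] with w hw
    exact stripLog_eq_sub (mem_ball_zero_iff.1 hw)
  · field_simp
    ring

theorem hasSum_stripLog (hz : ‖z‖ < 1) :
    HasSum (fun n : ℕ => (1 - Complex.exp (2 * a * Complex.I) ^ (n + 1)) / ((n : ℂ) + 1) *
      z ^ (n + 1)) (stripLog a z) := by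
  have h1 := Complex.hasSum_taylorSeries_neg_log hz
  have h2 := Complex.hasSum_taylorSeries_neg_log
    (z := Complex.exp (2 * a * Complex.I) * z) (by rwa [norm_exp_two_mul_I_mul])
  have h3 := (hasSum_nat_add_iff' 1).2 (h1.sub h2)
  simp only [Finset.sum_range_one, pow_zero, Nat.cast_zero, div_zero, sub_zero] at h3
  rw [stripLog_eq_sub hz, show ∀ x y : ℂ, x - y = -y - -x by intros; ring]
  refine h3.congr_fun ?_
  intro n
  rw [mul_pow]
  push_cast
  ring

@[simp] theorem stripLog_zero (a : ℝ) : stripLog a 0 = 0 := by simp [stripLog]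

theorem stripLog_ne_zero (ha : 0 < a) (ha' : a < Real.pi) (hz : ‖z‖ < 1) (h0 : z ≠ 0) :
    stripLog a z ≠ 0 := by
  intro h
  have h1 := exp_stripLog (a := a) hz
  rw [h, Complex.exp_zero, eq_comm, div_eq_one_iff_eq (ne_zero_of_re_pos (one_sub_re_pos hz))] at h1
  exact mul_ne_zero (one_sub_exp_two_mul_I_ne_zero ha ha') h0 (by linear_combination h1)

theorem exp_stripLog_sub_im_neg (ha : 0 < a) (ha' : a < Real.pi) (hz : ‖z‖ < 1) :
    (Complex.exp (stripLog a z - a * Complex.I)).im < 0 := by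
  have hs := Real.sin_pos_of_pos_of_lt_pi ha ha'
  have hd := ne_zero_of_re_pos (one_sub_re_pos hz)
  have h1 : Complex.exp (stripLog a z - a * Complex.I) =
      (Complex.exp ((-a : ℝ) * Complex.I) - Complex.exp (a * Complex.I) * z) / (1 - z) := by
    rw [sub_eq_add_neg, Complex.exp_add, exp_stripLog hz, div_mul_eq_mul_div, sub_mul, one_mul,
      mul_right_comm, ← Complex.exp_add]
    push_cast
    ring_nf
  have h2 : (Complex.exp (stripLog a z - a * Complex.I)).im =
      -(Real.sin a * (1 - Complex.normSq z)) / Complex.normSq (1 - z) := by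
    rw [h1, Complex.div_im, ← sub_div]
    congr 1
    simp only [Complex.sub_re, Complex.sub_im, Complex.mul_re, Complex.mul_im,
      Complex.exp_ofReal_mul_I_re, Complex.exp_ofReal_mul_I_im, Real.cos_neg, Real.sin_neg,
      Complex.one_re, Complex.one_im, Complex.normSq_apply]
    ring
  rw [h2]
  refine div_neg_of_neg_of_pos (neg_neg_of_pos (mul_pos hs ?_)) (Complex.normSq_pos.2 hd)
  rw [Complex.normSq_eq_norm_sq]
  nlinarith [norm_nonneg z]

theorem sub_im_stripLog_mem (ha : 0 < a) (ha' : a < Real.pi) (hz : ‖z‖ < 1) :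
    0 < a - (stripLog a z).im ∧ a - (stripLog a z).im < Real.pi := by
  have h1 := exp_stripLog_sub_im_neg ha ha' hz
  rw [Complex.exp_im] at h1
  have h2 := neg_of_mul_neg_right h1 (Real.exp_pos _).le
  have h3 : (stripLog a z - a * Complex.I).im = (stripLog a z).im - a := by simp
  rw [h3] at h2
  have h4 : -Real.pi < (stripLog a z).im := Complex.neg_pi_lt_log_im _
  have h5 : (stripLog a z).im ≤ Real.pi := Complex.log_im_le_pi _
  constructor
  · by_contra! h
    exact absurd h2 (not_lt.2 (Real.sin_nonneg_of_nonneg_of_le_pi (by linarith) (by linarith)))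
  · by_contra! h
    have := Real.sin_nonneg_of_nonneg_of_le_pi (x := (stripLog a z).im - a + 2 * Real.pi)
      (by linarith) (by linarith)
    rw [Real.sin_add_two_pi] at this
    linarith

theorem exp_stripLog_sub_ne (ha : 0 < a) (ha' : a < Real.pi) (hz : ‖z‖ < 1) :
    Complex.exp (stripLog a z - a * Complex.I) - Complex.exp (a * Complex.I) ≠ 0 := by
  intro h
  have h1 := exp_stripLog_sub_im_neg ha ha' hz
  rw [sub_eq_zero.1 h, Complex.exp_ofReal_mul_I_im] at h1
  linarith [Real.sin_pos_of_pos_of_lt_pi ha ha']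

theorem mul_exp_stripLog_sub (hz : ‖z‖ < 1) :
    z * (Complex.exp (stripLog a z - a * Complex.I) - Complex.exp (a * Complex.I)) =
      Complex.exp (stripLog a z - a * Complex.I) - (Complex.exp (a * Complex.I))⁻¹ := by
  have hd := ne_zero_of_re_pos (one_sub_re_pos hz)
  have hp := Complex.exp_ne_zero (a * Complex.I)
  rw [Complex.exp_sub, exp_stripLog hz, show 2 * a * Complex.I = a * Complex.I + a * Complex.I by ring,
    Complex.exp_add]
  field_simp
  ring

theorem re_mul_conj_stripLog_pos (ha : 0 < a) (ha' : a < Real.pi) (hz : ‖z‖ < 1) (h0 : z ≠ 0) :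
    0 < (z * (1 - Complex.exp (2 * a * Complex.I)) * (starRingEnd ℂ) (stripLog a z)).re := by
  obtain ⟨hy, hy'⟩ := sub_im_stripLog_mem ha ha' hz
  have hne := stripLog_ne_zero ha ha' hz h0
  have hzv := mul_exp_stripLog_sub (a := a) hz
  have hv := exp_stripLog_sub_ne ha ha' hz
  set u := stripLog a z
  set x := u.re with hx
  set y := a - u.im with hyd
  have hu : u = x + (a - y : ℝ) * Complex.I := by
    rw [hyd, sub_sub_cancel, hx, Complex.re_add_im]
  have hE := mul_sinh_mul_sin_add_pos (x := x) ha ha' hy hy' (by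
    by_contra! h
    exact hne (by rw [hu, h.1, h.2]; simp))
  have hs := Real.sin_pos_of_pos_of_lt_pi ha ha'
  set v := Complex.exp (u - a * Complex.I) with hvd
  set p := Complex.exp (a * Complex.I) with hp
  have hp0 : p ≠ 0 := Complex.exp_ne_zero _
  have hX0 : Complex.exp x ≠ 0 := Complex.exp_ne_zero _
  have hY0 : Complex.exp (y * Complex.I) ≠ 0 := Complex.exp_ne_zero _
  have hv1 : v = Complex.exp x / Complex.exp (y * Complex.I) := by
    rw [hvd, hu, ← Complex.exp_sub]; push_cast; ring_nf
  have hpc : (starRingEnd ℂ) p = p⁻¹ := by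
    rw [hp, ← Complex.exp_conj, ← Complex.exp_neg]; simp
  have hvc : (starRingEnd ℂ) v = Complex.exp x * Complex.exp (y * Complex.I) := by
    rw [hv1, map_div₀, ← Complex.exp_conj, ← Complex.exp_conj, ← Complex.exp_sub, ← Complex.exp_add]
    simp
  have hp2 : Complex.exp (2 * a * Complex.I) = p ^ 2 := by
    rw [hp, ← Complex.exp_nat_mul]; push_cast; ring_nf
  have hsin : 1 - p ^ 2 = -2 * Complex.I * Real.sin a * p := by
    rw [Complex.ofReal_sin, Complex.sin, neg_mul (a : ℂ), Complex.exp_neg, ← hp]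
    field_simp
    rw [Complex.I_sq]
    ring
  have hcosh : Complex.exp x * p + (Complex.exp x * p)⁻¹ =
      2 * (Real.cosh x * Real.cos a + Real.sinh x * Real.sin a * Complex.I) := by
    rw [hp, ← Complex.exp_add, ← Complex.exp_neg]
    have := Complex.cosh_add x (a * Complex.I)
    rw [Complex.cosh_mul_I, Complex.sinh_mul_I, Complex.cosh] at this
    push_cast
    linear_combination 2 * this
  have hcos : Complex.exp (y * Complex.I) + (Complex.exp (y * Complex.I))⁻¹ = 2 * Real.cos y := by
    rw [Complex.ofReal_cos, Complex.cos, neg_mul, Complex.exp_neg]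
    ring
  have key : z * (1 - Complex.exp (2 * a * Complex.I)) * (Complex.normSq (v - p) : ℂ) =
      ((4 * Real.sin a * Real.exp x : ℝ) : ℂ) * (Real.sinh x * Real.sin a -
        (Real.cosh x * Real.cos a - Real.cos y) * Complex.I) := by
    have h1 : z * (1 - Complex.exp (2 * a * Complex.I)) * (Complex.normSq (v - p) : ℂ) =
        -2 * Complex.I * Real.sin a * Complex.exp x *
          ((Complex.exp x * p + (Complex.exp x * p)⁻¹) -
            (Complex.exp (y * Complex.I) + (Complex.exp (y * Complex.I))⁻¹)) := by
      rw [← Complex.mul_conj, map_sub, hpc, hp2, hsin]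
      have h2 : z * (v - p) * (-2 * Complex.I * Real.sin a * p) * ((starRingEnd ℂ) v - p⁻¹) =
          -2 * Complex.I * Real.sin a * Complex.exp x *
          ((Complex.exp x * p + (Complex.exp x * p)⁻¹) -
            (Complex.exp (y * Complex.I) + (Complex.exp (y * Complex.I))⁻¹)) := by
        rw [hzv, hvc, hv1]
        field_simp
        ring
      linear_combination h2
    rw [h1, hcosh, hcos]
    push_cast
    linear_combination (-4 * Complex.sin a * Complex.exp x * (Complex.sinh x * Complex.sin a)) *
      Complex.I_sq
  have hN : 0 < Complex.normSq (v - p) := Complex.normSq_pos.2 hv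
  refine pos_of_mul_pos_left (b := Complex.normSq (v - p)) ?_ hN.le
  rw [← Complex.re_mul_ofReal, mul_right_comm, key, mul_assoc, Complex.re_ofReal_mul, hu]
  refine mul_pos (by positivity) (hE.trans_eq ?_)
  simp [-Complex.ofReal_sin, -Complex.ofReal_cos, -Complex.ofReal_sinh, -Complex.ofReal_cosh]
  ring

theorem re_mul_deriv_mul_conj_stripLog_pos (ha : 0 < a) (ha' : a < Real.pi) (hz : ‖z‖ < 1)
    (h0 : z ≠ 0) :
    0 < (z * ((1 - Complex.exp (2 * a * Complex.I)) /
      ((1 - z) * (1 - Complex.exp (2 * a * Complex.I) * z))) *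
        (starRingEnd ℂ) (stripLog a z)).re := by
  obtain ⟨hy, hy'⟩ := sub_im_stripLog_mem ha ha' hz
  have hne := stripLog_ne_zero ha ha' hz h0
  have hzv := mul_exp_stripLog_sub (a := a) hz
  have hv := exp_stripLog_sub_ne ha ha' hz
  have hd := ne_zero_of_re_pos (one_sub_re_pos hz)
  have hw := exp_stripLog (a := a) hz
  set u := stripLog a z
  set x := u.re with hx
  set y := a - u.im with hyd
  have hu : u = x + (a - y : ℝ) * Complex.I := by
    rw [hyd, sub_sub_cancel, hx, Complex.re_add_im]
  have hE := mul_sinh_mul_sin_add_pos (x := x) hy hy' ha ha' (by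
    by_contra! h
    exact hne (by rw [hu, h.1, h.2]; simp))
  have hs := Real.sin_pos_of_pos_of_lt_pi ha ha'
  set v := Complex.exp (u - a * Complex.I) with hvd
  set p := Complex.exp (a * Complex.I) with hp
  have hp0 : p ≠ 0 := Complex.exp_ne_zero _
  have hv0 : v ≠ 0 := Complex.exp_ne_zero _
  have hp2 : Complex.exp (2 * a * Complex.I) = p ^ 2 := by
    rw [hp, ← Complex.exp_nat_mul]; push_cast; ring_nf
  have hsin : p⁻¹ - p = -2 * Complex.I * Real.sin a := by
    rw [Complex.ofReal_sin, Complex.sin, neg_mul (a : ℂ), Complex.exp_neg, ← hp]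
    linear_combination (p⁻¹ - p) * Complex.I_sq
  have hcos : p + p⁻¹ = 2 * Real.cos a := by
    rw [Complex.ofReal_cos, Complex.cos, neg_mul (a : ℂ), Complex.exp_neg, ← hp]
    ring
  have hcosh : v + v⁻¹ =
      2 * (Real.cosh x * Real.cos y - Real.sinh x * Real.sin y * Complex.I) := by
    have := Complex.cosh_sub x (y * Complex.I)
    rw [Complex.cosh_mul_I, Complex.sinh_mul_I, Complex.cosh,
      show (x : ℂ) - y * Complex.I = u - a * Complex.I by rw [hu]; push_cast; ring,
      Complex.exp_neg, ← hvd] at this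
    push_cast
    linear_combination 2 * this
  have hs0 : (Real.sin a : ℂ) ≠ 0 := Complex.ofReal_ne_zero.2 hs.ne'
  have hd2 : p⁻¹ - p ≠ 0 := by
    rw [hsin]; exact mul_ne_zero (mul_ne_zero (by norm_num) Complex.I_ne_zero) hs0
  have hw' : 1 - p ^ 2 * z = v * p * (1 - z) := by
    rw [hp2, eq_div_iff hd] at hw
    rw [← hw, hvd, hp, ← Complex.exp_add, sub_add_cancel]
  have h1z : 1 - z = (p⁻¹ - p) / (v - p) := by
    rw [eq_div_iff hv]; linear_combination -hzv
  have key : z * ((1 - Complex.exp (2 * a * Complex.I)) /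
      ((1 - z) * (1 - Complex.exp (2 * a * Complex.I) * z))) =
      (((Real.sin a)⁻¹ : ℝ) : ℂ) * (Real.sinh x * Real.sin y +
        (Real.cosh x * Real.cos y - Real.cos a) * Complex.I) := by
    have h1 : z * ((1 - Complex.exp (2 * a * Complex.I)) /
        ((1 - z) * (1 - Complex.exp (2 * a * Complex.I) * z))) =
        ((v + v⁻¹) - (p + p⁻¹)) / (p⁻¹ - p) := by
      rw [hp2, hw', h1z, eq_div_of_mul_eq hv hzv,
        show 1 - p ^ 2 = p * (p⁻¹ - p) by field_simp]
      generalize hD : p⁻¹ - p = D at hd2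
      field_simp
      ring
    rw [h1, hcosh, hcos, hsin, div_eq_iff (hsin ▸ hd2), Complex.ofReal_inv]
    field_simp
    ring_nf
    rw [Complex.I_sq]
    ring
  rw [key, mul_assoc, Complex.re_ofReal_mul, hu]
  refine mul_pos (inv_pos.2 hs) (hE.trans_eq ?_)
  simp [-Complex.ofReal_sin, -Complex.ofReal_cos, -Complex.ofReal_sinh, -Complex.ofReal_cosh]
  ring

end StripLog

section Slope

variable {a : ℝ} {z : ℂ}

/-- The function `stripLog a z / z`, extended to `z = 0`, divided by its value there. -/
noncomputable def stripLogSlope (a : ℝ) (z : ℂ) : ℂ :=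
  dslope (stripLog a) 0 z / (1 - Complex.exp (2 * a * Complex.I))

theorem stripLog_eq_mul_slope (ha : 0 < a) (ha' : a < Real.pi) (z : ℂ) :
    stripLog a z = z * (1 - Complex.exp (2 * a * Complex.I)) * stripLogSlope a z := by
  have h := sub_smul_dslope (stripLog a) 0 z
  have h1 := one_sub_exp_two_mul_I_ne_zero ha ha'
  rw [stripLog_zero, sub_zero, sub_zero, smul_eq_mul] at h
  rw [stripLogSlope, ← h]
  field_simp

theorem stripLogSlope_zero (ha : 0 < a) (ha' : a < Real.pi) : stripLogSlope a 0 = 1 := by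
  rw [stripLogSlope, dslope_same, (hasDerivAt_stripLog (by simp)).deriv]
  simp [one_sub_exp_two_mul_I_ne_zero ha ha']

theorem differentiableOn_stripLogSlope (a : ℝ) :
    DifferentiableOn ℂ (stripLogSlope a) (ball 0 1) := by
  refine DifferentiableOn.div_const ?_ _
  rw [Complex.differentiableOn_dslope (isOpen_ball.mem_nhds (mem_ball_self one_pos))]
  exact fun z hz =>
    (hasDerivAt_stripLog (mem_ball_zero_iff.1 hz)).differentiableAt.differentiableWithinAt

theorem hasDerivAt_stripLogSlope (a : ℝ) (hz : z ∈ ball (0 : ℂ) 1) :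
    HasDerivAt (stripLogSlope a) (deriv (stripLogSlope a) z) z :=
  ((differentiableOn_stripLogSlope a).differentiableAt (isOpen_ball.mem_nhds hz)).hasDerivAt

theorem re_div_pos_of_re_mul_conj_pos {z w : ℂ} (h : 0 < (z * (starRingEnd ℂ) w).re) :
    0 < (z / w).re := by
  have hw : w ≠ 0 := fun h0 => by simp [h0] at h
  rw [div_eq_mul_inv, Complex.inv_def, ← mul_assoc, Complex.re_mul_ofReal]
  exact mul_pos h (inv_pos.2 (Complex.normSq_pos.2 hw))

theorem re_stripLogSlope_pos (ha : 0 < a) (ha' : a < Real.pi) (hz : z ∈ ball (0 : ℂ) 1) :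
    0 < (stripLogSlope a z).re := by
  rcases eq_or_ne z 0 with rfl | h0
  · simp [stripLogSlope_zero ha ha']
  · have h1 := re_div_pos_of_re_mul_conj_pos
      (re_mul_conj_stripLog_pos ha ha' (mem_ball_zero_iff.1 hz) h0)
    rw [stripLog_eq_mul_slope ha ha' z, div_mul_cancel_left₀
      (mul_ne_zero h0 (one_sub_exp_two_mul_I_ne_zero ha ha')), Complex.inv_re] at h1
    exact (div_pos_iff_of_pos_right (Complex.normSq_pos.2 fun h => by simp [h] at h1)).1 h1

theorem re_one_add_stripLogSlope_nonneg (ha : 0 < a) (ha' : a < Real.pi)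
    (hz : z ∈ ball (0 : ℂ) 1) :
    0 ≤ (1 + z * deriv (stripLogSlope a) z / stripLogSlope a z).re := by
  rcases eq_or_ne z 0 with rfl | h0
  · simp
  · have hz1 := mem_ball_zero_iff.1 hz
    have h1 := re_div_pos_of_re_mul_conj_pos (re_mul_deriv_mul_conj_stripLog_pos ha ha' hz1 h0)
    have h2 : HasDerivAt (stripLog a) _ z :=
      (((hasDerivAt_id z).mul_const (1 - Complex.exp (2 * a * Complex.I))).mul
        (hasDerivAt_stripLogSlope a hz)).congr_of_eventuallyEq
        (Filter.Eventually.of_forall fun w => stripLog_eq_mul_slope ha ha' w)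
    have hne := one_sub_exp_two_mul_I_ne_zero ha ha'
    have hq := Complex.ne_zero_of_re_pos (re_stripLogSlope_pos ha ha' hz)
    rw [(hasDerivAt_stripLog hz1).unique h2, stripLog_eq_mul_slope ha ha' z] at h1
    refine h1.le.trans_eq (congrArg Complex.re ?_)
    simp only [id]
    field_simp

end Slope

theorem P_sub_one (α β : ℝ) (z : ℂ) : P α β z - 1 =
    ((β : ℂ) - α) / Real.pi * Complex.I *
      stripLog (Real.pi * (1 - α) / (β - α)) z := by
  rw [P, stripLog, add_sub_cancel_left]
  push_cast
  congr 7
  ring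

theorem pi_mul_div_mem_Ioo {α β : ℝ} (hα : α < 1) (hβ : 1 < β) :
    Real.pi * (1 - α) / (β - α) ∈ Set.Ioo 0 Real.pi := by
  refine ⟨div_pos (mul_pos Real.pi_pos (by linarith)) (by linarith), ?_⟩
  rw [div_lt_iff₀ (by linarith)]
  exact mul_lt_mul_of_pos_left (by linarith) Real.pi_pos

theorem norm_ofReal_mul_lt_one {z : ℂ} (hz : ‖z‖ < 1) {t : ℝ} (ht : t ∈ Set.Icc (0 : ℝ) 1) :
    ‖(t : ℂ) * z‖ < 1 := by
  rw [norm_mul, Complex.norm_real, Real.norm_of_nonneg ht.1]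
  exact (mul_le_of_le_one_left (norm_nonneg z) ht.2).trans_lt hz

theorem Phat_eq_const_mul_primitive {α β : ℝ} (hα : α < 1) (hβ : 1 < β) {f : ℂ → ℂ}
    (hf : ∀ z ∈ ball (0 : ℂ) 1,
      HasDerivAt f (stripLogSlope (Real.pi * (1 - α) / (β - α)) z) z)
    {z : ℂ} (hz : z ∈ ball (0 : ℂ) 1) :
    Phat α β z = ((β : ℂ) - α) / Real.pi * Complex.I *
      (1 - Complex.exp (2 * (Real.pi * (1 - α) / (β - α) : ℝ) * Complex.I)) * (f z - f 0) := by
  obtain ⟨ha, ha'⟩ := pi_mul_div_mem_Ioo hα hβ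
  set a := Real.pi * (1 - α) / (β - α) with had
  have hz1 := mem_ball_zero_iff.1 hz
  have hmem : ∀ t ∈ Set.Icc (0 : ℝ) 1, (t : ℂ) * z ∈ ball (0 : ℂ) 1 := fun t ht =>
    mem_ball_zero_iff.2 (norm_ofReal_mul_lt_one hz1 ht)
  have hline : ∀ t : ℝ, HasDerivAt (fun t : ℝ => (t : ℂ) * z) z t := fun t => by
    simpa using (Complex.ofRealCLM.hasDerivAt (x := t)).mul_const z
  have hd : ∀ t ∈ Set.uIcc (0 : ℝ) 1,
      HasDerivAt (fun t : ℝ => f (t * z)) (stripLogSlope a (t * z) * z) t := by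
    intro t ht
    rw [Set.uIcc_of_le zero_le_one] at ht
    exact (hf _ (hmem t ht)).comp_of_eq t (hline t) rfl
  have hcont : ContinuousOn (fun t : ℝ => stripLogSlope a (t * z) * z) (Set.uIcc 0 1) := by
    rw [Set.uIcc_of_le zero_le_one]
    exact ((differentiableOn_stripLogSlope a).continuousOn.comp (by fun_prop) hmem).mul
      continuousOn_const
  have hftc := intervalIntegral.integral_eq_sub_of_hasDerivAt hd hcont.intervalIntegrable
  simp only [Complex.ofReal_one, one_mul, Complex.ofReal_zero, zero_mul] at hftc
  rw [← hftc, ← intervalIntegral.integral_const_mul, Phat]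
  refine intervalIntegral.integral_congr_ae (Filter.Eventually.of_forall fun t ht => ?_)
  rw [Set.uIoc_of_le zero_le_one] at ht
  rcases eq_or_ne z 0 with rfl | h0
  · simp
  · have ht0 : (t : ℂ) ≠ 0 := Complex.ofReal_ne_zero.2 ht.1.ne'
    rw [P_sub_one, ← had, stripLog_eq_mul_slope ha ha']
    field_simp

theorem hasSum_Phat (α β : ℝ) {z : ℂ} (hz : ‖z‖ < 1) :
    HasSum (fun n : ℕ => (((β : ℂ) - α) / (Real.pi * ((n : ℂ) + 1) ^ 2)) * Complex.I *
      (1 - Complex.exp (2 * Real.pi * ((n : ℂ) + 1) * Complex.I *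
        (1 - (α : ℂ)) / ((β : ℂ) - α))) * z ^ (n + 1)) (Phat α β z) := by
  set a := Real.pi * (1 - α) / (β - α) with had
  set k : ℂ := ((β : ℂ) - α) / Real.pi * Complex.I with hk
  set c : ℕ → ℂ := fun n =>
    k * ((1 - Complex.exp (2 * a * Complex.I) ^ (n + 1)) / ((n : ℂ) + 1)) with hc
  have hcn : ∀ n, ‖c n‖ ≤ ‖k‖ * 2 := by
    intro n
    have h1 : ‖Complex.exp (2 * a * Complex.I) ^ (n + 1)‖ = 1 := by
      have := norm_exp_two_mul_I_mul a 1
      rw [mul_one, norm_one] at this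
      rw [norm_pow, this, one_pow]
    have h2 : ‖(n : ℂ) + 1‖ = n + 1 := by
      rw [← Nat.cast_add_one, Complex.norm_natCast, Nat.cast_add_one]
    rw [hc, norm_mul, norm_div, h2]
    refine mul_le_mul_of_nonneg_left ?_ (norm_nonneg k)
    refine (div_le_self (norm_nonneg _) (by linarith [(Nat.cast_nonneg n : (0 : ℝ) ≤ n)])).trans ?_
    refine (norm_sub_le _ _).trans ?_
    rw [h1, norm_one]
    norm_num
  have hsum : HasSum (fun n : ℕ => ∫ t in (0 : ℝ)..1, c n * ((t : ℂ) * z) ^ n * z)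
      (∫ t in (0 : ℝ)..1, (P α β ((t : ℂ) * z) - 1) / ((t : ℂ) * z) * z) := by
    refine intervalIntegral.hasSum_integral_of_dominated_convergence
      (fun n _ => ‖k‖ * 2 * ‖z‖ ^ n * ‖z‖) (fun n => ?_) (fun n => ?_) ?_ ?_ ?_
    · exact (by fun_prop : Continuous fun t : ℝ => c n * ((t : ℂ) * z) ^ n * z).aestronglyMeasurable
    · refine Filter.Eventually.of_forall fun t ht => ?_
      rw [Set.uIoc_of_le zero_le_one] at ht
      have h1 : ‖(t : ℂ) * z‖ ≤ ‖z‖ := by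
        rw [norm_mul, Complex.norm_real, Real.norm_of_nonneg ht.1.le]
        exact mul_le_of_le_one_left (norm_nonneg z) ht.2
      rw [norm_mul, norm_mul, norm_pow]
      gcongr
      exact hcn n
    · exact Filter.Eventually.of_forall fun t _ =>
        ((summable_geometric_of_lt_one (norm_nonneg z) hz).mul_left _).mul_right _
    · exact intervalIntegrable_const
    · refine Filter.Eventually.of_forall fun t ht => ?_
      rw [Set.uIoc_of_le zero_le_one] at ht
      rcases eq_or_ne z 0 with rfl | h0
      · simp
      · have ht0 : (t : ℂ) ≠ 0 := Complex.ofReal_ne_zero.2 ht.1.ne'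
        have h1 := (((hasSum_stripLog (a := a)
          (norm_ofReal_mul_lt_one hz ⟨ht.1.le, ht.2⟩)).mul_left k).div_const ((t : ℂ) * z)).mul_right z
        rw [P_sub_one, ← had]
        refine h1.congr_fun fun n => ?_
        simp only [hc]
        field_simp
        ring
  rw [Phat]
  refine hsum.congr_fun fun n => ?_
  have hn : (n : ℂ) + 1 ≠ 0 := Nat.cast_add_one_ne_zero n
  have hint : ∫ t in (0 : ℝ)..1, c n * ((t : ℂ) * z) ^ n * z =
      c n * z ^ (n + 1) * ((n : ℂ) + 1)⁻¹ := by
    have h1 : ∫ t in (0 : ℝ)..1, (t : ℂ) ^ n = ((n : ℂ) + 1)⁻¹ := by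
      have h2 : ∫ t in (0 : ℝ)..1, (t : ℂ) ^ n = ((∫ t in (0 : ℝ)..1, t ^ n : ℝ) : ℂ) := by
        rw [← intervalIntegral.integral_ofReal]
        push_cast
        rfl
      rw [h2, integral_pow]
      simp
    rw [← h1, ← intervalIntegral.integral_const_mul]
    congr 1
    ext t
    ring
  have hexp : Complex.exp (2 * Real.pi * ((n : ℂ) + 1) * Complex.I *
      (1 - (α : ℂ)) / ((β : ℂ) - α)) = Complex.exp (2 * a * Complex.I) ^ (n + 1) := by
    rw [← Complex.exp_nat_mul, had]
    push_cast
    congr 1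
    ring
  rw [hint, hexp]
  simp only [hc, hk]
  field_simp

/-- `P̂_{α,β}(z) = Σ_{n≥1} ((β-α)/(πn²)) i (1 - e^{2πni(1-α)/(β-α)}) zⁿ` is
convex univalent on the unit disc. -/
theorem Phat_series_and_convex_univalent (α β : ℝ) (hα : α < 1) (hβ : 1 < β) :
    (∀ z ∈ ball (0 : ℂ) 1,
      HasSum
        (fun n : ℕ =>
          (((β : ℂ) - α) / (Real.pi * ((n : ℂ) + 1) ^ 2)) * Complex.I *
            (1 - Complex.exp (2 * Real.pi * ((n : ℂ) + 1) * Complex.I *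
              (1 - (α : ℂ)) / ((β : ℂ) - α))) * z ^ (n + 1))
        (Phat α β z)) ∧
    Set.InjOn (Phat α β) (ball 0 1) ∧
    Convex ℝ (Phat α β '' ball 0 1) := by
  refine ⟨fun z hz => hasSum_Phat α β (mem_ball_zero_iff.1 hz), ?_⟩
  obtain ⟨ha, ha'⟩ := pi_mul_div_mem_Ioo hα hβ
  obtain ⟨f, hf⟩ := (differentiableOn_stripLogSlope
    (Real.pi * (1 - α) / (β - α))).isExactOn_ball
  have hre := fun z hz => re_stripLogSlope_pos (z := z) ha ha' hz
  have hPhat := fun z hz => Phat_eq_const_mul_primitive (z := z) hα hβ hf hz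
  have hk : ((β : ℂ) - α) / Real.pi * Complex.I *
      (1 - Complex.exp (2 * (Real.pi * (1 - α) / (β - α) : ℝ) * Complex.I)) ≠ 0 := by
    refine mul_ne_zero (mul_ne_zero (div_ne_zero ?_ (Complex.ofReal_ne_zero.2 Real.pi_ne_zero))
      Complex.I_ne_zero) (one_sub_exp_two_mul_I_ne_zero ha ha')
    rw [← Complex.ofReal_sub]
    exact Complex.ofReal_ne_zero.2 (by linarith)
  set k := ((β : ℂ) - α) / Real.pi * Complex.I *
      (1 - Complex.exp (2 * (Real.pi * (1 - α) / (β - α) : ℝ) * Complex.I))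
  constructor
  · intro z hz w hw hzw
    rw [hPhat z hz, hPhat w hw] at hzw
    exact injOn_of_re_deriv_pos (convex_ball 0 1) hf hre hz hw
      (sub_left_injective (mul_left_cancel₀ hk hzw))
  · have hconv := convex_image_unit_ball hf (fun z hz => hasDerivAt_stripLogSlope _ hz) hre
      fun z hz => re_one_add_stripLogSlope_nonneg ha ha' hz
    have himage : Phat α β '' ball 0 1 =
        (fun w => -(k * f 0) + w) '' (LinearMap.mulLeft ℝ k '' (f '' ball 0 1)) := by
      rw [Set.image_image, Set.image_image]
      refine Set.image_congr fun z hz => ?_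
      rw [hPhat z hz, LinearMap.mulLeft_apply]
      ring
    rw [himage]
    exact (hconv.linear_image _).translate _
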